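/- Let F be a family of convex pseudo-discs of a set P of n points in general position in the plane. If no member of F is contained in another, then |F| ≤ 4·C(n,2) + 1. -/

import Mathlib

/-- Twice the signed area of the triangle `p q r`; positive iff it is counterclockwise. -/
def orient (p q r : ℝ × ℝ) : ℝ :=
  (q.1 - p.1) * (r.2 - p.2) - (q.2 - p.2) * (r.1 - p.1)

lemma orient_rotate (p q r : ℝ × ℝ) : orient p q r = orient q r p := by
  unfold orient; ring

lemma orient_swap (p q r : ℝ × ℝ) : orient p q r = -orient p r q := by
  unfold orient; ring

lemma orient_self_left (p q : ℝ × ℝ) : orient p q p = 0 := by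
  unfold orient; ring

lemma orient_self_right (p q : ℝ × ℝ) : orient p q q = 0 := by
  unfold orient; ring

lemma orient_combo (p q x y : ℝ × ℝ) {a b : ℝ} (hab : a + b = 1) :
    orient p q (a • x + b • y) = a * orient p q x + b * orient p q y := by
  obtain rfl : b = 1 - a := by linarith
  simp only [orient, Prod.fst_add, Prod.snd_add, Prod.smul_fst, Prod.smul_snd, smul_eq_mul]
  ring

lemma continuous_orient (p q : ℝ × ℝ) : Continuous (orient p q) := by
  unfold orient; fun_prop

lemma exists_eq_of_orient_eq_zero {p q r : ℝ × ℝ} (hpq : p ≠ q) (h : orient p q r = 0) :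
    ∃ t : ℝ, r = t • (q - p) + p := by
  unfold orient at h
  by_cases h1 : q.1 - p.1 = 0
  · have h2 : q.2 - p.2 ≠ 0 := fun h2 =>
      hpq (Prod.ext (by linarith) (by linarith))
    refine ⟨(r.2 - p.2) / (q.2 - p.2), Prod.ext ?_ ?_⟩
    · have : r.1 - p.1 = 0 := by
        rw [h1] at h
        have : (q.2 - p.2) * (r.1 - p.1) = 0 := by linarith
        exact (mul_eq_zero.1 this).resolve_left h2
      simp [h1]; linarith
    · simp [h2]
  · refine ⟨(r.1 - p.1) / (q.1 - p.1), Prod.ext ?_ ?_⟩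
    · simp [h1]
    · simp only [Prod.snd_add, Prod.smul_snd, Prod.snd_sub, smul_eq_mul]
      field_simp
      linarith

lemma collinear_of_orient_eq_zero {p q r : ℝ × ℝ} (hpq : p ≠ q) (h : orient p q r = 0) :
    Collinear ℝ ({p, q, r} : Set (ℝ × ℝ)) := by
  obtain ⟨t, ht⟩ := exists_eq_of_orient_eq_zero hpq h
  rw [collinear_iff_of_mem (p₀ := p) (by simp)]
  refine ⟨q - p, ?_⟩
  simp only [Set.mem_insert_iff, Set.mem_singleton_iff, forall_eq_or_imp, forall_eq, vadd_eq_add]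
  exact ⟨⟨0, by simp⟩, ⟨1, by simp⟩, ⟨t, ht⟩⟩

lemma convex_orient_nonpos (p q : ℝ × ℝ) : Convex ℝ {z | orient p q z ≤ 0} := by
  intro x hx y hy a b ha hb hab
  simp only [Set.mem_ofPred_eq] at *
  rw [orient_combo _ _ _ _ hab]
  nlinarith

/-- The points of `S` seen from a vertex `b` of its convex hull are sorted by angle. -/
lemma exists_angular_key {S : Finset (ℝ × ℝ)} {b : ℝ × ℝ}
    (hb : b ∉ convexHull ℝ ((S : Set (ℝ × ℝ)) \ {b})) :
    ∃ key : ℝ × ℝ → ℝ, ∀ x ∈ S, ∀ y ∈ S, x ≠ b → y ≠ b →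
      (orient b x y < 0 ↔ key x < key y) := by
  obtain ⟨f, u, hfb, hf⟩ := geometric_hahn_banach_point_closed
    (convex_convexHull ℝ ((S : Set (ℝ × ℝ)) \ {b}))
    ((S.finite_toSet.subset Set.sdiff_subset).isClosed_convexHull ℝ) hb
  have hpos : ∀ x ∈ S, x ≠ b → 0 < f (x - b) := fun x hx hxb => by
    have := hf x (subset_convexHull ℝ _ ⟨hx, hxb⟩)
    rw [map_sub]; linarith
  have hlin : ∀ v : ℝ × ℝ, f v = v.1 * f (1, 0) + v.2 * f (0, 1) := fun v => by
    have hv : v = v.1 • ((1, 0) : ℝ × ℝ) + v.2 • ((0, 1) : ℝ × ℝ) := by ext <;> simp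
    calc f v = f (v.1 • ((1, 0) : ℝ × ℝ) + v.2 • ((0, 1) : ℝ × ℝ)) := congrArg f hv
      _ = v.1 * f (1, 0) + v.2 * f (0, 1) := by
        rw [map_add, map_smul, map_smul, smul_eq_mul, smul_eq_mul]
  set m := f (1, 0)
  set k := f (0, 1)
  refine ⟨fun z => ((z - b).1 * k - (z - b).2 * m) / f (z - b), fun x hx y hy hxb hyb => ?_⟩
  have h1 := hpos x hx hxb
  have h2 := hpos y hy hyb
  rw [div_lt_div_iff₀ h1 h2]
  rw [hlin] at h1 h2
  rw [hlin (x - b), hlin (y - b)]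
  have hmk : 0 < m ^ 2 + k ^ 2 := by
    by_contra hcon
    have hm : m = 0 := by nlinarith [sq_nonneg m, sq_nonneg k]
    have hk : k = 0 := by nlinarith [sq_nonneg m, sq_nonneg k]
    simp [hm, hk] at h1
  have key : ((y - b).1 * k - (y - b).2 * m) * ((x - b).1 * m + (x - b).2 * k)
      - ((x - b).1 * k - (x - b).2 * m) * ((y - b).1 * m + (y - b).2 * k)
      = -(m ^ 2 + k ^ 2) * orient b x y := by
    simp only [orient, Prod.fst_sub, Prod.snd_sub]; ring
  constructor
  · intro h; nlinarith
  · intro h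
    by_contra hcon
    nlinarith [mul_nonneg hmk.le (not_lt.1 hcon)]

/-- A hull vertex has a successor along the boundary of the convex hull. -/
lemma exists_hull_successor {S : Finset (ℝ × ℝ)} {p : ℝ × ℝ}
    (hp : p ∉ convexHull ℝ ((S : Set (ℝ × ℝ)) \ {p})) (hne : ∃ b ∈ S, b ≠ p) :
    ∃ q ∈ S, q ≠ p ∧ ∀ z ∈ S, orient p q z ≤ 0 := by
  obtain ⟨key, hkey⟩ := exists_angular_key hp
  obtain ⟨q, hq, hmin⟩ := (S.erase p).exists_min_image key
    (hne.imp fun b hb => Finset.mem_erase.2 ⟨hb.2, hb.1⟩)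
  rw [Finset.mem_erase] at hq
  refine ⟨q, hq.2, hq.1, fun z hz => ?_⟩
  by_cases hzp : z = p
  · rw [hzp, orient_self_left]
  · by_contra hcon
    have h1 : orient p z q < 0 := by rw [orient_swap]; linarith
    have := (hkey z hz q hq.2 hzp hq.1).1 h1
    have := hmin z (Finset.mem_erase.2 ⟨hzp, hz⟩)
    linarith

/-- The head of a hull edge containing no other points is a hull vertex. -/
lemma notMem_convexHull_of_hull_edge {S : Set (ℝ × ℝ)} {p q : ℝ × ℝ} (hqp : q ≠ p)
    (h : ∀ z ∈ S, z ≠ p → z ≠ q → orient p q z < 0) : q ∉ convexHull ℝ (S \ {q}) := by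
  have hconv : Convex ℝ {z | orient p q z < 0 ∨ z = p} := by
    intro x hx y hy a b ha hb hab
    simp only [Set.mem_ofPred_eq] at *
    rw [orient_combo _ _ _ _ hab]
    rcases ha.eq_or_lt with rfl | ha
    · obtain rfl : b = 1 := by linarith
      simpa using hy
    rcases hb.eq_or_lt with rfl | hb
    · obtain rfl : a = 1 := by linarith
      simpa using hx
    rcases hx with hx | rfl
    · rcases hy with hy | rfl
      · left; nlinarith
      · left; rw [orient_self_left]; nlinarith
    · rcases hy with hy | rfl
      · left; rw [orient_self_left]; nlinarith
      · right; rw [← add_smul, hab, one_smul]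
  intro hq
  have hsub : S \ {q} ⊆ {z | orient p q z < 0 ∨ z = p} := fun z hz =>
    or_iff_not_imp_right.2 fun hzp => h z hz.1 hzp hz.2
  rcases convexHull_min hsub hconv hq with h' | h'
  · rw [orient_self_right] at h'; exact lt_irrefl _ h'
  · exact hqp h'

/-- If `S` does not lie in the convex hull of `A`, then `S` has a hull vertex outside `A`. -/
lemma exists_hull_vertex_notMem {A S : Finset (ℝ × ℝ)}
    (h : ¬ (S : Set (ℝ × ℝ)) ⊆ convexHull ℝ (A : Set (ℝ × ℝ))) :
    ∃ b ∈ S, b ∉ A ∧ b ∉ convexHull ℝ ((S : Set (ℝ × ℝ)) \ {b}) := by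
  by_contra! hcon
  refine h ((subset_convexHull ℝ _).trans ?_)
  rw [← closure_convexHull_extremePoints (S.finite_toSet.isCompact_convexHull ℝ)
    (convex_convexHull ℝ _)]
  refine closure_minimal (convexHull_mono fun b hb => ?_) (A.finite_toSet.isClosed_convexHull ℝ)
  by_contra hbA
  refine ((convex_convexHull ℝ _).mem_extremePoints_iff_mem_sdiff_convexHull_sdiff.1 hb).2 ?_
  exact convexHull_mono (Set.sdiff_subset_sdiff_left (subset_convexHull ℝ _))
    (hcon b (extremePoints_convexHull_subset hb) hbA)

section Pair

variable {A B : Finset (ℝ × ℝ)}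

/-- The boundary of the hull of `A ∪ B` leaves `A \ B` at least once. -/
lemma exists_transition
    (hgen : ∀ p ∈ A ∪ B, ∀ q ∈ A ∪ B, ∀ r ∈ A ∪ B, p ≠ q → p ≠ r → q ≠ r → orient p q r ≠ 0)
    (hA : ¬ (A : Set (ℝ × ℝ)) ⊆ convexHull ℝ (B : Set (ℝ × ℝ)))
    (hB : ¬ (B : Set (ℝ × ℝ)) ⊆ convexHull ℝ (A : Set (ℝ × ℝ))) :
    ∃ p ∈ A, p ∉ B ∧ ∃ q ∈ B, ∀ z ∈ A ∪ B, orient p q z ≤ 0 := by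
  classical
  obtain ⟨b, hbS, hbA, hb⟩ := exists_hull_vertex_notMem (A := A) (S := A ∪ B)
    fun h => hB (Set.Subset.trans (by simp) h)
  obtain ⟨a, haS, haB, ha⟩ := exists_hull_vertex_notMem (A := B) (S := A ∪ B)
    fun h => hA (Set.Subset.trans (by simp) h)
  have hbB : b ∈ B := (Finset.mem_union.1 hbS).resolve_left hbA
  obtain ⟨key, hkey⟩ := exists_angular_key hb
  set E := (A ∪ B).filter fun p =>
    p ∉ B ∧ p ∉ convexHull ℝ (((A ∪ B : Finset (ℝ × ℝ)) : Set (ℝ × ℝ)) \ {p})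
  obtain ⟨p, hp, hmax⟩ := E.exists_max_image key ⟨a, Finset.mem_filter.2 ⟨haS, haB, ha⟩⟩
  obtain ⟨hpS, hpB, hpv⟩ := Finset.mem_filter.1 hp
  have hpb : b ≠ p := fun h => hpB (h ▸ hbB)
  obtain ⟨q, hqS, hqp, hq⟩ := exists_hull_successor hpv ⟨b, hbS, hpb⟩
  refine ⟨p, (Finset.mem_union.1 hpS).resolve_right hpB, hpB, q, ?_, hq⟩
  by_contra hqB
  have hqb : b ≠ q := fun h => hqB (h ▸ hbB)
  have hqE : q ∈ E := Finset.mem_filter.2 ⟨hqS, hqB,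
    notMem_convexHull_of_hull_edge hqp fun z hz hzp hzq =>
      lt_of_le_of_ne (hq z hz) (hgen p hpS q hqS z hz hqp.symm hzp.symm hzq.symm)⟩
  have hlt : orient b p q < 0 := by
    rw [orient_rotate]
    exact lt_of_le_of_ne (hq b hbS) (hgen p hpS q hqS b hbS hqp.symm hpb.symm hqb.symm)
  exact absurd ((hkey p hpS q hqS hpb.symm hqb.symm).1 hlt) (not_lt.2 (hmax q hqE))

/-- A chord between two hull vertices of `A ∪ B` in `B` cannot separate `A \ B`. -/
lemma not_opposite_sides
    (hpre : IsPreconnected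
      (convexHull ℝ (A : Set (ℝ × ℝ)) \ convexHull ℝ (B : Set (ℝ × ℝ))))
    {p q p' q' : ℝ × ℝ} (hp : p ∈ A) (hq : q ∈ B) (hp' : p' ∈ A) (hq' : q' ∈ B)
    (hpB : p ∉ convexHull ℝ (B : Set (ℝ × ℝ))) (hpB' : p' ∉ convexHull ℝ (B : Set (ℝ × ℝ)))
    (h : ∀ z ∈ A ∪ B, orient p q z ≤ 0) (h' : ∀ z ∈ A ∪ B, orient p' q' z ≤ 0)
    (hlt : orient p q q' < 0) (hlt' : orient p' q' q < 0) : False := by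
  have hne : q ≠ q' := by
    rintro rfl
    rw [orient_self_right] at hlt; exact lt_irrefl _ hlt
  have hcover : convexHull ℝ (A : Set (ℝ × ℝ)) \ convexHull ℝ (B : Set (ℝ × ℝ)) ⊆
      {z | orient q q' z < 0} ∪ {z | 0 < orient q q' z} := by
    rintro z ⟨hzA, hzB⟩
    by_contra hcon
    simp only [Set.mem_union, Set.mem_ofPred_eq, not_or, not_lt] at hcon
    obtain ⟨t, rfl⟩ := exists_eq_of_orient_eq_zero hne (le_antisymm hcon.2 hcon.1)
    have e : t • (q' - q) + q = t • q' + (1 - t) • q := by module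
    rw [e] at hzA hzB
    have h1 : orient p q (t • q' + (1 - t) • q) ≤ 0 :=
      convexHull_min (fun x hx => h x (Finset.mem_union_left _ hx)) (convex_orient_nonpos p q) hzA
    have h2 : orient p' q' (t • q' + (1 - t) • q) ≤ 0 :=
      convexHull_min (fun x hx => h' x (Finset.mem_union_left _ hx))
        (convex_orient_nonpos p' q') hzA
    rw [orient_combo _ _ _ _ (by ring), orient_self_right] at h1 h2
    have ht0 : 0 ≤ t := by nlinarith
    have ht1 : 0 ≤ 1 - t := by nlinarith
    exact hzB (convex_convexHull ℝ _ (subset_convexHull ℝ _ hq') (subset_convexHull ℝ _ hq)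
      ht0 ht1 (by ring))
  obtain ⟨z, -, hz1, hz2⟩ := hpre _ _
    (isOpen_lt (continuous_orient q q') continuous_const)
    (isOpen_lt continuous_const (continuous_orient q q')) hcover
    ⟨p, ⟨subset_convexHull ℝ _ hp, hpB⟩, by
      simpa [orient_rotate p q q'] using hlt⟩
    ⟨p', ⟨subset_convexHull ℝ _ hp', hpB'⟩, by
      rw [orient_swap, orient_rotate] at hlt'
      simpa using hlt'⟩
  simp only [Set.mem_ofPred_eq] at hz1 hz2
  linarith

/-- The boundary of the hull of `A ∪ B` leaves `A \ B` at most once. -/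
lemma transition_unique
    (hgen : ∀ p ∈ A ∪ B, ∀ q ∈ A ∪ B, ∀ r ∈ A ∪ B, p ≠ q → p ≠ r → q ≠ r → orient p q r ≠ 0)
    (hconv : ∀ x ∈ A, x ∉ B → x ∉ convexHull ℝ (B : Set (ℝ × ℝ)))
    (hpre : IsPreconnected
      (convexHull ℝ (A : Set (ℝ × ℝ)) \ convexHull ℝ (B : Set (ℝ × ℝ))))
    {p q p' q' : ℝ × ℝ} (hp : p ∈ A) (hpB : p ∉ B) (hq : q ∈ B)
    (hp' : p' ∈ A) (hpB' : p' ∉ B) (hq' : q' ∈ B)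
    (h : ∀ z ∈ A ∪ B, orient p q z ≤ 0) (h' : ∀ z ∈ A ∪ B, orient p' q' z ≤ 0) :
    p = p' ∧ q = q' := by
  have mA : ∀ {x}, x ∈ A → x ∈ A ∪ B := Finset.mem_union_left _
  have mB : ∀ {x}, x ∈ B → x ∈ A ∪ B := Finset.mem_union_right _
  have hpq : p ≠ q := fun e => hpB (e ▸ hq)
  have hpq' : p ≠ q' := fun e => hpB (e ▸ hq')
  have hp'q : p' ≠ q := fun e => hpB' (e ▸ hq)
  have hp'q' : p' ≠ q' := fun e => hpB' (e ▸ hq')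
  by_cases hqq : q = q'
  · subst hqq
    refine ⟨?_, rfl⟩
    by_contra hpp
    have h1 := lt_of_le_of_ne (h p' (mA hp'))
      (hgen p (mA hp) q (mB hq) p' (mA hp') hpq hpp hp'q.symm)
    have h2 := h' p (mA hp)
    rw [← orient_rotate, orient_swap] at h2
    linarith
  · exfalso
    have h1 := lt_of_le_of_ne (h q' (mB hq'))
      (hgen p (mA hp) q (mB hq) q' (mB hq') hpq hpq' hqq)
    have h2 := lt_of_le_of_ne (h' q (mB hq))
      (hgen p' (mA hp') q' (mB hq') q (mB hq) hp'q' hp'q (Ne.symm hqq))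
    exact not_opposite_sides hpre hp hq hp' hq' (hconv p hp hpB) (hconv p' hp' hpB') h h' h1 h2

end Pair

/-- If the matrix with zero diagonal and all other entries one factors through `ι`,
then it has at most `|ι| + 1` rows. -/
lemma card_le_of_factorization {α ι : Type*} [Fintype α] [Fintype ι] [DecidableEq α]
    (u w : α → ι → ℝ) (h : ∀ a b, ∑ i, u a i * w b i = if a = b then 0 else 1) :
    Fintype.card α ≤ Fintype.card ι + 1 := by
  have hli : LinearIndependent ℝ fun b : α => ((w b, 1) : (ι → ℝ) × ℝ) := by
    rw [Fintype.linearIndependent_iff]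
    intro c hc a
    have h1 : ∀ i, ∑ b, c b * w b i = 0 := fun i => by
      have := congrFun (congrArg Prod.fst hc) i
      simpa [Prod.fst_sum] using this
    have h2 : ∑ b, c b = 0 := by
      have := congrArg Prod.snd hc
      simpa [Prod.snd_sum] using this
    have h3 : ∑ b, c b * ∑ i, u a i * w b i = 0 := by
      simp only [Finset.mul_sum]
      rw [Finset.sum_comm]
      refine Finset.sum_eq_zero fun i _ => ?_
      calc ∑ b, c b * (u a i * w b i) = u a i * ∑ b, c b * w b i := by
            rw [Finset.mul_sum]; exact Finset.sum_congr rfl fun b _ => by ring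
        _ = 0 := by rw [h1, mul_zero]
    have h4 : ∑ b, c b * (if a = b then (0 : ℝ) else 1) = ∑ b, c b - c a := by
      have : ∀ b, c b * (if a = b then (0 : ℝ) else 1) = c b - if a = b then c b else 0 :=
        fun b => by split_ifs <;> simp
      simp [this]
    simp only [h] at h3
    linarith
  simpa using hli.fintype_card_le_finrank

/-- If `F` is a family of convex pseudo-discs of a set `P` of `n`
points in general position (each member is `P` intersected with a convex set,
and for distinct members the hull differences are connected or empty), and no
member of `F` is contained in another, then `|F| ≤ 4·C(n,2) + 1`. -/
theorem stmt9 (n : ℕ) (P : Finset (ℝ × ℝ)) (hcard : P.card = n)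
    (hgen : ∀ p ∈ P, ∀ q ∈ P, ∀ r ∈ P, p ≠ q → p ≠ r → q ≠ r →
      ¬ Collinear ℝ ({p, q, r} : Set (ℝ × ℝ)))
    (F : Finset (Finset (ℝ × ℝ)))
    (hconv : ∀ A ∈ F, ∃ C : Set (ℝ × ℝ), Convex ℝ C ∧
      (A : Set (ℝ × ℝ)) = ↑P ∩ C)
    (hpd : ∀ A ∈ F, ∀ B ∈ F, A ≠ B →
      IsPreconnected (convexHull ℝ (A : Set (ℝ × ℝ)) \ convexHull ℝ (B : Set (ℝ × ℝ))) ∧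
      IsPreconnected (convexHull ℝ (B : Set (ℝ × ℝ)) \ convexHull ℝ (A : Set (ℝ × ℝ))))
    (hanti : ∀ A ∈ F, ∀ B ∈ F, A ⊆ B → A = B) :
    F.card ≤ 4 * n.choose 2 + 1 := by
  classical
  have hsub : ∀ A ∈ F, A ⊆ P := fun A hA x hx => by
    obtain ⟨C, -, hC⟩ := hconv A hA
    have : x ∈ (A : Set (ℝ × ℝ)) := hx
    rw [hC] at this
    exact this.1
  have hout : ∀ A ∈ F, ∀ x ∈ P, x ∉ A → x ∉ convexHull ℝ (A : Set (ℝ × ℝ)) := by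
    intro A hA x hx hxA hxc
    obtain ⟨C, hCc, hC⟩ := hconv A hA
    have hxC : x ∈ C := convexHull_min (hC ▸ Set.inter_subset_right) hCc hxc
    exact hxA (Finset.mem_coe.1 (hC ▸ ⟨hx, hxC⟩))
  have hnot : ∀ A ∈ F, ∀ B ∈ F, A ≠ B →
      ¬ (A : Set (ℝ × ℝ)) ⊆ convexHull ℝ (B : Set (ℝ × ℝ)) := by
    intro A hA B hB hne hAB
    refine hne (hanti A hA B hB fun x hx => ?_)
    by_contra hxB
    exact hout B hB x (hsub A hA hx) hxB (hAB hx)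
  have key : ∀ A B : F, ∑ i : P.offDiag,
      (if i.1.1 ∈ A.1 ∧ ∀ z ∈ A.1, orient i.1.1 i.1.2 z ≤ 0 then (1 : ℝ) else 0) *
      (if i.1.1 ∉ B.1 ∧ i.1.2 ∈ B.1 ∧ ∀ z ∈ B.1, orient i.1.1 i.1.2 z ≤ 0 then (1 : ℝ) else 0)
      = if A = B then 0 else 1 := by
    rintro ⟨A, hA⟩ ⟨B, hB⟩
    simp only [Subtype.mk.injEq]
    split_ifs with hAB
    · subst hAB
      refine Finset.sum_eq_zero fun i _ => ?_
      split_ifs <;> simp_all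
    · have hgen' : ∀ p ∈ A ∪ B, ∀ q ∈ A ∪ B, ∀ r ∈ A ∪ B, p ≠ q → p ≠ r → q ≠ r →
          orient p q r ≠ 0 := fun p hp q hq r hr h1 h2 h3 h0 =>
        have hABP := Finset.union_subset (hsub A hA) (hsub B hB)
        hgen p (hABP hp) q (hABP hq) r (hABP hr) h1 h2 h3 (collinear_of_orient_eq_zero h1 h0)
      obtain ⟨p, hp, hpB, q, hq, hpq⟩ := exists_transition hgen'
        (hnot A hA B hB hAB) (hnot B hB A hA (Ne.symm hAB))
      have hi : (p, q) ∈ P.offDiag := Finset.mem_offDiag.2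
        ⟨hsub A hA hp, hsub B hB hq, fun e : p = q => hpB (e ▸ hq)⟩
      rw [Finset.sum_eq_single_of_mem ⟨(p, q), hi⟩ (Finset.mem_univ _)]
      · rw [if_pos ⟨hp, fun z hz => hpq z (Finset.mem_union_left _ hz)⟩,
          if_pos ⟨hpB, hq, fun z hz => hpq z (Finset.mem_union_right _ hz)⟩, one_mul]
      · rintro ⟨⟨p', q'⟩, hi'⟩ - hne
        by_contra hcon
        simp only [mul_eq_zero, ite_eq_right_iff, one_ne_zero, imp_false, not_or, not_not] at hcon
        obtain ⟨⟨hp', h1⟩, hpB', hq', h2⟩ := hcon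
        obtain ⟨rfl, rfl⟩ := transition_unique hgen'
          (fun x hx hxB => hout B hB x (hsub A hA hx) hxB) (hpd A hA B hB hAB).1
          hp' hpB' hq' hp hpB hq
          (fun z hz => (Finset.mem_union.1 hz).elim (h1 z) (h2 z)) hpq
        exact hne rfl
  have hle := card_le_of_factorization _ _ key
  rw [Fintype.card_coe, Fintype.card_coe, Finset.offDiag_card, hcard] at hle
  have hch : n * n - n = 2 * n.choose 2 := by
    rw [Nat.choose_two_right, Nat.mul_div_cancel' (Nat.even_mul_pred_self n).two_dvd,
      Nat.mul_sub_one]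
  omega
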